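/- Let F be a finite field, let ℓ ≥ 1, m_A ≥ 1, m_B ≥ 1 be integers with gcd(ℓ·m_A, m_B) = 1, and let a, b be integers with a·ℓ·m_A + b·m_B = 1. Let g^A ∈ F[X] divide X^{m_A} − 1, let f_1, …, f_{ℓ−1} ∈ F[X], and let A be the 1-level ℓ-quasi-cyclic code of length ℓ·m_A whose codewords, written as ℓ-tuples of component polynomials in F[X]/(X^{m_A} − 1), form the F[X]-submodule of (F[X]/(X^{m_A} − 1))^ℓ generated by the image of the row (g^A, g^A f_1, …, g^A f_{ℓ−1}). Let B be the cyclic code of length m_B with generator polynomial g^B dividing X^{m_B} − 1. Let R = F[X]/(X^{m_A·m_B} − 1) with X̄ the (unit) image of X, and set u = X̄^{a·ℓ·m_A}, v = X̄^{b·m_B}, w = X̄^{a·m_A}. Let p ∈ F[X] be any polynomial whose image in R equals g^A(v)·g^B(u), and let g = gcd(X^{m_A·m_B} − 1, p) in F[X]. Then the set of ℓ-tuples (c̄_0, …, c̄_{ℓ−1}) ∈ R^ℓ of (images of) component polynomials of serialized codewords of the product code A ⊗ B, where the serialization of a codeword matrix M is c(X) = Σ_{i,j} M_{i,j} X^{λ(i,j)}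 with λ(i,j) = (i·a·ℓ²·m_A + j·b·m_B) mod (ℓ·m_A·m_B) and c(X) = Σ_h c_h(X^ℓ) X^h, is exactly the R-submodule of R^ℓ generated by the single row (ḡ, ḡ·f_1(v)·w^{−1}, …, ḡ·f_{ℓ−1}(v)·w^{−(ℓ−1)}), where ḡ is the image of g in R. In particular, the product code A ⊗ B is a 1-level ℓ-quasi-cyclic code. -/

import Mathlib

set_option synthInstance.maxHeartbeats 1000000
set_option maxHeartbeats 1000000
open Polynomial

/-- The monic gcd on `F[X]`. -/
noncomputable instance (F : Type*) [Field F] : NormalizedGCDMonoid (Polynomial F) :=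
  letI := Classical.decEq F
  Polynomial.normalizedGcdMonoid

/-- `F[X]/(X^N − 1)`. -/
noncomputable abbrev QR (F : Type*) [Field F] (N : ℕ) : Type _ :=
  Polynomial F ⧸ Ideal.span {(X : Polynomial F) ^ N - 1}

theorem mk_X_pow_eq_one (F : Type*) [Field F] (N : ℕ) :
    (Ideal.Quotient.mk (Ideal.span {(X : Polynomial F) ^ N - 1}) (X ^ N)) = 1 := by
  have hmem : (X : Polynomial F) ^ N - 1 ∈ Ideal.span {(X : Polynomial F) ^ N - 1} :=
    Ideal.subset_span rfl
  have h0 := Ideal.Quotient.eq_zero_iff_mem.mpr hmem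
  rw [map_sub, map_one, sub_eq_zero] at h0
  exact h0

/-- The image `X̄` of `X` in `F[X]/(X^N − 1)`, as a unit of that ring. -/
noncomputable def Xu (F : Type*) [Field F] (N : ℕ) (hN : 0 < N) : (QR F N)ˣ where
  val := Ideal.Quotient.mk _ X
  inv := Ideal.Quotient.mk _ (X ^ (N - 1))
  val_inv := by
    rw [← map_mul, ← pow_succ', Nat.sub_add_cancel hN]
    exact mk_X_pow_eq_one F N
  inv_val := by
    rw [← map_mul, ← pow_succ, Nat.sub_add_cancel hN]
    exact mk_X_pow_eq_one F N

/-- The index `j·ℓ + h` as an element of `Fin (ℓ·m_A)`. -/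
def idx {ℓ mA : ℕ} (j : Fin mA) (h : Fin ℓ) : Fin (ℓ * mA) :=
  ⟨(j : ℕ) * ℓ + (h : ℕ), by
    calc (j : ℕ) * ℓ + (h : ℕ) < (j : ℕ) * ℓ + ℓ := Nat.add_lt_add_left h.isLt _
    _ = ((j : ℕ) + 1) * ℓ := by ring
    _ ≤ mA * ℓ := Nat.mul_le_mul_right ℓ j.isLt
    _ = ℓ * mA := Nat.mul_comm mA ℓ⟩

/-- The `h`-th component polynomial (of degree `< m_A·m_B`) of the serialization
`c(X) = Σ_{i,j} M_{i,j} X^{λ(i,j)}` of a codeword matrix `M`, where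
`λ(i,j) = (i·a·ℓ²·m_A + j·b·m_B) mod (ℓ·m_A·m_B)` and
`c(X) = Σ_h c_h(X^ℓ)·X^h`. -/
noncomputable def serComp (F : Type*) [Field F] (ℓ mA mB : ℕ) (a b : ℤ)
    (M : Fin mB → Fin (ℓ * mA) → F) (h : ℕ) : Polynomial F :=
  ∑ k ∈ Finset.range (mA * mB),
    C ((∑ i : Fin mB, ∑ j : Fin (ℓ * mA),
        C (M i j) * X ^ ((((i : ℤ) * a * ℓ ^ 2 * mA + (j : ℤ) * b * mB) %
          (ℓ * mA * mB : ℕ)).toNat)).coeff (k * ℓ + h)) * X ^ k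


theorem aeval_X_pow_sub_one_eq_zero {F R : Type*} [Field F] [CommRing R] [Algebra F R]
    {m : ℕ} {x : R} (hx : x ^ m = 1) : aeval x ((X : F[X]) ^ m - 1) = 0 := by
  simp [hx]

/-- Evaluation at an `m`-th root of unity factors through `F[X]/(X^m − 1)`. -/
theorem aeval_eq_of_mk_eq {F R : Type*} [Field F] [CommRing R] [Algebra F R]
    {m : ℕ} {x : R} (hx : x ^ m = 1) {p q : F[X]}
    (h : Ideal.Quotient.mk (Ideal.span {(X : F[X]) ^ m - 1}) p = Ideal.Quotient.mk _ q) :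
    aeval x p = aeval x q := by
  rw [Ideal.Quotient.eq, Ideal.mem_span_singleton] at h
  obtain ⟨s, hs⟩ := h
  rw [← sub_eq_zero, ← map_sub, hs, map_mul, aeval_X_pow_sub_one_eq_zero hx, zero_mul]

theorem mk_modByMonic_X_pow_sub_one {F : Type*} [Field F] (m : ℕ) (p : F[X]) :
    Ideal.Quotient.mk (Ideal.span {(X : F[X]) ^ m - 1}) (p %ₘ (X ^ m - 1)) =
      Ideal.Quotient.mk _ p := by
  rw [Ideal.Quotient.eq, Ideal.mem_span_singleton, modByMonic_eq_sub_mul_div]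
  exact ⟨-(p /ₘ (X ^ m - 1)), by ring⟩

theorem sum_coeff_modByMonic_X_pow_sub_one {F : Type*} [Field F] {m : ℕ} (hm : 1 ≤ m) (p : F[X]) :
    ∑ i : Fin m, C ((p %ₘ (X ^ m - 1)).coeff i) * X ^ (i : ℕ) = p %ₘ (X ^ m - 1) := by
  have hmonic : ((X : F[X]) ^ m - 1).Monic := monic_X_pow_sub_C 1 (by omega)
  simp only [C_mul_X_pow_eq_monomial]
  exact sum_modByMonic_coeff hmonic (by rw [← C_1, degree_X_pow_sub_C (by omega)])

/-- A constant divisor of `q * s`, with `q` having coefficients in the base field, divides `s`. -/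
theorem C_dvd_of_C_dvd_map_mul {F : Type*} [Field F] {q : F[X]} (hq : q ≠ 0) {r : F[X]}
    {s : F[X][X]} (h : C r ∣ q.map C * s) : C r ∣ s := by
  have hprim : (q.map (C : F →+* F[X])).IsPrimitive := by
    intro c hc
    rw [C_dvd_iff_dvd_coeff] at hc
    have := hc q.natDegree
    rw [coeff_map] at this
    exact isUnit_of_dvd_unit this
      ((isUnit_iff_ne_zero.mpr (leadingCoeff_ne_zero.mpr hq)).map C)
  rw [← dvd_content_iff_C_dvd, (associated_content_mul _ _).dvd_iff_dvd_right,
    hprim.content_eq_one, one_mul] at h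
  exact dvd_content_iff_C_dvd.mp h

/-- The polynomial of an array whose rows are divisible by `p` and whose columns are divisible
by `q` is divisible by `p(v) q(u)`. -/
theorem exists_sum_eq_mul_aeval_mul_aeval {F R : Type*} [Field F] [CommRing R] [Algebra F R]
    (u v : R) {m n : ℕ} {p q : F[X]} (hp : p ≠ 0) (N : Fin n → Fin m → F)
    (hrow : ∀ i, p ∣ ∑ j, C (N i j) * X ^ (j : ℕ))
    (hcol : ∀ j, q ∣ ∑ i, C (N i j) * X ^ (i : ℕ)) :
    ∃ r : R, ∑ i, ∑ j, algebraMap F R (N i j) * u ^ (i : ℕ) * v ^ (j : ℕ) =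
      r * (aeval v p * aeval u q) := by
  let D : F[X][X] := ∑ i, ∑ j, C (C (N i j) * X ^ (i : ℕ)) * X ^ (j : ℕ)
  have hpD : p.map C ∣ D := by
    refine Finset.dvd_sum fun i _ => ?_
    have : ∑ j, C (C (N i j) * (X : F[X]) ^ (i : ℕ)) * X ^ (j : ℕ) =
        C (X ^ (i : ℕ)) * (∑ j, C (N i j) * X ^ (j : ℕ)).map C := by
      simp only [Polynomial.map_sum, Finset.mul_sum, Polynomial.map_mul, Polynomial.map_pow,
        map_C, map_X, C_mul]
      exact Finset.sum_congr rfl fun j _ => by ring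
    rw [this]
    exact (Polynomial.map_dvd C (hrow i)).mul_left _
  have hqD : C q ∣ D := by
    have : D = ∑ j, C (∑ i, C (N i j) * (X : F[X]) ^ (i : ℕ)) * X ^ (j : ℕ) := by
      simp only [D, map_sum, Finset.sum_mul]
      exact Finset.sum_comm
    rw [this]
    exact Finset.dvd_sum fun j _ => (_root_.map_dvd C (hcol j)).mul_right _
  obtain ⟨Q, hQ⟩ := hpD
  obtain ⟨S, rfl⟩ := C_dvd_of_C_dvd_map_mul hp (hQ ▸ hqD)
  let ev : F[X][X] →+* R := eval₂RingHom (aeval u : F[X] →ₐ[F] R).toRingHom v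
  have hev := congrArg ev hQ
  have hmap : ev (p.map C) = aeval v p := by
    simp only [ev, coe_eval₂RingHom, eval₂_map, aeval_def]
    congr 1
    ext c
    simp
  rw [map_mul, map_mul, hmap] at hev
  refine ⟨ev S, ?_⟩
  have hD : ev D = ∑ i, ∑ j, algebraMap F R (N i j) * u ^ (i : ℕ) * v ^ (j : ℕ) := by
    simp only [D, map_sum, ev, coe_eval₂RingHom, eval₂_mul, eval₂_C, eval₂_X_pow]
    simp
  have hC : ev (C q) = aeval u q := by simp [ev]
  rw [← hD, hev, hC]
  ring

/-- The position of the `(i, jℓ + h)` entry is `kℓ + h` with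
`k = (i·a·ℓ·m_A + j·b·m_B − h·a·m_A) mod m_A·m_B`. -/
theorem serialization_index {ℓ mA mB : ℕ} (hmA : 1 ≤ mA) (hmB : 1 ≤ mB) {a b : ℤ}
    (hab : a * ℓ * mA + b * mB = 1) (i j : ℤ) (h : Fin ℓ) :
    (i * a * ℓ ^ 2 * mA + (j * ℓ + (h : ℕ)) * b * mB) % (ℓ * mA * mB : ℕ) =
      ((i * (a * ℓ * mA) + j * (b * mB) - (h : ℕ) * a * mA) % (mA * mB : ℕ)) * ℓ + (h : ℕ) := by
  set e : ℤ := i * (a * ℓ * mA) + j * (b * mB) - (h : ℕ) * a * mA with he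
  have hn : (0 : ℤ) < (mA * mB : ℕ) := by positivity
  have h0 := Int.emod_nonneg e hn.ne'
  have h1 := Int.emod_lt_of_pos e hn
  have h2 := Int.emod_add_mul_ediv e (mA * mB : ℕ)
  set r := e % (mA * mB : ℕ)
  set q := e / (mA * mB : ℕ)
  have hh : ((h : ℕ) : ℤ) < ℓ := by exact_mod_cast h.isLt
  have key : i * a * ℓ ^ 2 * mA + (j * ℓ + (h : ℕ)) * b * mB =
      (r * ℓ + (h : ℕ)) + (ℓ * mA * mB : ℕ) * q := by
    have : (r + (mA * mB : ℕ) * q) * ℓ = e * ℓ := by rw [h2]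
    push_cast at this ⊢
    rw [he] at this
    linear_combination -this + (h : ℕ) * hab
  rw [key, Int.add_mul_emod_self_left, Int.emod_eq_of_lt (by positivity)]
  push_cast at h1 ⊢
  nlinarith

theorem idx_bijective (ℓ mA : ℕ) :
    Function.Bijective fun x : Fin mA × Fin ℓ => idx x.1 x.2 := by
  have : (fun x : Fin mA × Fin ℓ => idx x.1 x.2) =
      finProdFinEquiv.trans (finCongr (Nat.mul_comm mA ℓ)) := by
    ext x
    simp [idx, mul_comm, add_comm]
  rw [this]
  exact Equiv.bijective _

theorem Xu_pow_eq_one (F : Type*) [Field F] (N : ℕ) (hN : 0 < N) : Xu F N hN ^ N = 1 := by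
  ext
  rw [Units.val_pow_eq_pow_val, Units.val_one]
  simpa [Xu] using mk_X_pow_eq_one F N

theorem Xu_zpow_mul_pow_eq_one (F : Type*) [Field F] (N : ℕ) (hN : 0 < N) {e : ℤ} {m : ℕ}
    (h : (N : ℤ) ∣ e * m) : ((Xu F N hN ^ e : (QR F N)ˣ) : QR F N) ^ m = 1 := by
  obtain ⟨c, hc⟩ := h
  rw [← Units.val_pow_eq_pow_val, ← zpow_natCast, ← zpow_mul, hc, zpow_mul, zpow_natCast,
    Xu_pow_eq_one, one_zpow, Units.val_one]

theorem Xu_pow_emod_toNat (F : Type*) [Field F] (N : ℕ) (hN : 0 < N) (e : ℤ) :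
    Xu F N hN ^ (e % N).toNat = Xu F N hN ^ e := by
  have h0 : 0 ≤ e % N := Int.emod_nonneg _ (by omega)
  conv_rhs => rw [← Int.emod_add_mul_ediv e N, zpow_add, zpow_mul, zpow_natCast, Xu_pow_eq_one,
    one_zpow, mul_one, ← Int.toNat_of_nonneg h0, zpow_natCast]

/-- The components of the serialization, as evaluations of bivariate polynomials. -/
theorem mk_serComp (F : Type*) [Field F] {ℓ mA mB : ℕ} (hmA : 1 ≤ mA) (hmB : 1 ≤ mB) {a b : ℤ}
    (hab : a * ℓ * mA + b * mB = 1) (M : Fin mB → Fin (ℓ * mA) → F) (h : Fin ℓ) :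
    Ideal.Quotient.mk (Ideal.span {(X : F[X]) ^ (mA * mB) - 1}) (serComp F ℓ mA mB a b M h) =
      (∑ i : Fin mB, ∑ j : Fin mA, algebraMap F (QR F (mA * mB)) (M i (idx j h)) *
        (↑(Xu F (mA * mB) (Nat.mul_pos hmA hmB) ^ (a * ℓ * mA)) : QR F (mA * mB)) ^ (i : ℕ) *
        (↑(Xu F (mA * mB) (Nat.mul_pos hmA hmB) ^ (b * mB)) : QR F (mA * mB)) ^ (j : ℕ)) *
      ↑(Xu F (mA * mB) (Nat.mul_pos hmA hmB) ^ (-((h : ℕ) : ℤ) * a * mA)) := by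
  have hpos : 0 < mA * mB := Nat.mul_pos hmA hmB
  set U := Xu F (mA * mB) hpos with hU
  let e (i : Fin mB) (j : Fin mA) (h' : Fin ℓ) : ℤ :=
    (i : ℕ) * (a * ℓ * mA) + (j : ℕ) * (b * mB) - (h' : ℕ) * a * mA
  have hidx (i : Fin mB) (j : Fin mA) (h' : Fin ℓ) :
      ((((i : ℕ) : ℤ) * a * ℓ ^ 2 * mA + ((idx j h' : ℕ) : ℤ) * b * mB) %
        (ℓ * mA * mB : ℕ)).toNat = (e i j h' % (mA * mB : ℕ)).toNat * ℓ + h' := by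
    have := serialization_index hmA hmB hab (i : ℕ) (j : ℕ) h'
    have h0 : 0 ≤ e i j h' % (mA * mB : ℕ) := Int.emod_nonneg _ (by omega)
    rw [idx, Nat.cast_add, Nat.cast_mul, this]
    rw [Int.toNat_add (by positivity) (by positivity), Int.toNat_mul h0 (by positivity),
      Int.toNat_natCast, Int.toNat_natCast]
  have hcoeff (k : ℕ) : (∑ i : Fin mB, ∑ j : Fin (ℓ * mA),
        C (M i j) * (X : F[X]) ^ ((((i : ℤ) * a * ℓ ^ 2 * mA + (j : ℤ) * b * mB) %
          (ℓ * mA * mB : ℕ)).toNat)).coeff (k * ℓ + h) =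
      ∑ i : Fin mB, ∑ j : Fin mA,
        if k = (e i j h % (mA * mB : ℕ)).toNat then M i (idx j h) else 0 := by
    simp only [finsetSum_coeff, coeff_C_mul_X_pow]
    refine Finset.sum_congr rfl fun i _ => ?_
    rw [← (idx_bijective ℓ mA).sum_comp, Fintype.sum_prod_type]
    refine Finset.sum_congr rfl fun j _ => ?_
    simp only [hidx]
    rw [Finset.sum_eq_single h]
    · simp [(Nat.pos_of_ne_zero (by have := h.isLt; omega) : 0 < ℓ).ne']
    · intro h' _ hne
      refine if_neg fun heq => hne (Fin.ext ?_)
      have := congrArg (· % ℓ) heq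
      simpa [Nat.mul_add_mod', Nat.mod_eq_of_lt] using this.symm
    · simp
  have hval (i : Fin mB) (j : Fin mA) :
      ((U ^ (a * ℓ * mA) : (QR F (mA * mB))ˣ) : QR F (mA * mB)) ^ (i : ℕ) *
        (↑(U ^ (b * mB)) : QR F (mA * mB)) ^ (j : ℕ) * ↑(U ^ (-((h : ℕ) : ℤ) * a * mA)) =
      (U : QR F (mA * mB)) ^ (e i j h % (mA * mB : ℕ)).toNat := by
    rw [← Units.val_pow_eq_pow_val U, hU, Xu_pow_emod_toNat, ← hU]
    simp only [← Units.val_pow_eq_pow_val, ← Units.val_mul, ← zpow_natCast, ← zpow_mul, ← zpow_add]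
    congr 2
    simp only [e]
    ring
  have hmk : ∀ c : F, Ideal.Quotient.mk (Ideal.span {(X : F[X]) ^ (mA * mB) - 1}) (C c) =
    algebraMap F (QR F (mA * mB)) c := fun _ => rfl
  have hmkX : Ideal.Quotient.mk (Ideal.span {(X : F[X]) ^ (mA * mB) - 1}) X = U := rfl
  simp only [serComp, map_sum, map_mul, map_pow, hcoeff, Finset.sum_mul, hmk, hmkX]
  rw [Finset.sum_comm]
  refine Finset.sum_congr rfl fun i _ => ?_
  rw [Finset.sum_comm]
  refine Finset.sum_congr rfl fun j _ => ?_
  have hlt : (e i j h % (mA * mB : ℕ)).toNat < mA * mB := by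
    have := Int.emod_lt_of_pos (e i j h) (b := (mA * mB : ℕ)) (by exact_mod_cast hpos)
    omega
  rw [mul_assoc, mul_assoc, ← mul_assoc (_ ^ _), hval,
    Finset.sum_eq_single_of_mem _ (Finset.mem_range.mpr hlt)]
  · simp
  · intro k _ hk
    rw [if_neg hk, map_zero, zero_mul]
/-- Multiples of `gA(v) gB(u)` by elements of `F[X]/(X^n − 1)` come from codeword matrices. -/
theorem exists_codeword_matrix (F : Type*) [Field F] {R : Type*} [CommRing R] [Algebra F R]
    {ℓ mA mB : ℕ} (hmA : 1 ≤ mA) (hmB : 1 ≤ mB) {u v : R} (hu : u ^ mB = 1) (hv : v ^ mA = 1)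
    (gA gB : F[X]) (hgB : gB ∣ X ^ mB - 1) (f : Fin ℓ → F[X]) (r : F[X]) :
    ∃ M : Fin mB → Fin (ℓ * mA) → F,
      (∀ i : Fin mB,
        (fun h : Fin ℓ => Ideal.Quotient.mk (Ideal.span {(X : F[X]) ^ mA - 1})
            (∑ j : Fin mA, C (M i (idx j h)) * X ^ (j : ℕ))) ∈
          Submodule.span F[X]
            {fun h : Fin ℓ => Ideal.Quotient.mk (Ideal.span {(X : F[X]) ^ mA - 1})
              (gA * f h)}) ∧
      (∀ j : Fin (ℓ * mA), gB ∣ ∑ i : Fin mB, C (M i j) * X ^ (i : ℕ)) ∧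
      ∀ h : Fin ℓ, ∑ i : Fin mB, ∑ j : Fin mA, algebraMap F R (M i (idx j h)) *
        u ^ (i : ℕ) * v ^ (j : ℕ) = aeval (u * v) r * (aeval v gA * aeval u gB) * aeval v (f h) := by
  induction r using Polynomial.induction_on' with
  | add r s hr hs =>
    obtain ⟨M, hM1, hM2, hM3⟩ := hr
    obtain ⟨N, hN1, hN2, hN3⟩ := hs
    refine ⟨fun i j => M i j + N i j, fun i => ?_, fun j => ?_, fun h => ?_⟩
    · convert Submodule.add_mem _ (hM1 i) (hN1 i) using 1
      ext h
      simp only [add_mul, Finset.sum_add_distrib, map_add, Pi.add_apply]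
    · simp only [C_add, add_mul, Finset.sum_add_distrib]
      exact dvd_add (hM2 j) (hN2 j)
    · simp only [map_add, add_mul, Finset.sum_add_distrib, hM3, hN3]
  | monomial n c =>
    let e := Equiv.ofBijective _ (idx_bijective ℓ mA)
    have he (j : Fin mA) (h : Fin ℓ) : e.symm (idx j h) = (j, h) := e.symm_apply_apply (j, h)
    let P : F[X] := (X ^ n * gB) %ₘ (X ^ mB - 1)
    let Q (h : Fin ℓ) : F[X] := (X ^ n * (gA * f h)) %ₘ (X ^ mA - 1)
    have hP : ∑ i : Fin mB, C (P.coeff i) * X ^ (i : ℕ) = P :=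
      sum_coeff_modByMonic_X_pow_sub_one hmB _
    have hQ (h : Fin ℓ) : ∑ j : Fin mA, C ((Q h).coeff j) * X ^ (j : ℕ) = Q h :=
      sum_coeff_modByMonic_X_pow_sub_one hmA _
    have hPu : aeval u P = u ^ n * aeval u gB := by
      rw [aeval_eq_of_mk_eq hu (mk_modByMonic_X_pow_sub_one mB (X ^ n * gB))]
      simp
    have hQv (h : Fin ℓ) : aeval v (Q h) = v ^ n * (aeval v gA * aeval v (f h)) := by
      rw [aeval_eq_of_mk_eq hv (mk_modByMonic_X_pow_sub_one mA (X ^ n * (gA * f h)))]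
      simp
    refine ⟨fun i j => c * P.coeff i * (Q (e.symm j).2).coeff (e.symm j).1,
      fun i => ?_, fun j => ?_, fun h => ?_⟩
    · refine Submodule.mem_span_singleton.mpr ⟨C (c * P.coeff i) * X ^ n, ?_⟩
      ext h
      have hrow : ∑ j : Fin mA, C (c * P.coeff i * (Q h).coeff j) * (X : F[X]) ^ (j : ℕ) =
          C (c * P.coeff i) * Q h := by
        conv_rhs => rw [← hQ, Finset.mul_sum]
        exact Finset.sum_congr rfl fun j _ => by rw [C_mul, mul_assoc]
      simp only [he]
      rw [hrow, map_mul (Ideal.Quotient.mk _), mk_modByMonic_X_pow_sub_one, ← map_mul, ← mul_assoc]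
      rfl
    · have : ∑ i : Fin mB, C (c * P.coeff i * (Q (e.symm j).2).coeff (e.symm j).1) *
          (X : F[X]) ^ (i : ℕ) = C (c * (Q (e.symm j).2).coeff (e.symm j).1) * P := by
        conv_rhs => rw [← hP, Finset.mul_sum]
        exact Finset.sum_congr rfl fun i _ => by simp only [C_mul]; ring
      rw [this]
      refine Dvd.dvd.mul_left ?_ _
      exact (dvd_modByMonic_sub (X ^ n * gB) (X ^ mB - 1)).elim fun s hs => by
        rw [show P = _ from sub_eq_iff_eq_add.mp hs]
        exact dvd_add (hgB.mul_right _) (dvd_mul_left _ _)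
    · have hP' := congrArg (aeval u) hP
      have hQ' := congrArg (aeval v) (hQ h)
      rw [hPu] at hP'
      rw [hQv] at hQ'
      simp only [map_sum, map_mul, map_pow, aeval_C, aeval_X] at hP' hQ'
      have : aeval (u * v) (monomial n c) * (aeval v gA * aeval u gB) * aeval v (f h) =
          algebraMap F R c * ((u ^ n * aeval u gB) * (v ^ n * (aeval v gA * aeval v (f h)))) := by
        rw [aeval_monomial, mul_pow]
        ring
      rw [this, ← hP', ← hQ', Finset.sum_mul_sum, Finset.mul_sum]
      refine Finset.sum_congr rfl fun i _ => ?_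
      rw [Finset.mul_sum]
      refine Finset.sum_congr rfl fun j _ => ?_
      simp only [he, map_mul]
      ring

/-- In a quotient by `(N)`, the gcd of `N` and `p` generates the same ideal as `p`. -/
theorem mk_gcd_dvd_mk_and_mk_dvd_mk_gcd {F : Type*} [Field F] (N p : F[X]) :
    Ideal.Quotient.mk (Ideal.span {N}) (gcd N p) ∣ Ideal.Quotient.mk (Ideal.span {N}) p ∧
      Ideal.Quotient.mk (Ideal.span {N}) p ∣ Ideal.Quotient.mk (Ideal.span {N}) (gcd N p) := by
  refine ⟨map_dvd _ (gcd_dvd_right N p), ?_⟩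
  obtain ⟨x, y, hxy⟩ := exists_gcd_eq_mul_add_mul N p
  have hN : Ideal.Quotient.mk (Ideal.span {N}) N = 0 :=
    Ideal.Quotient.eq_zero_iff_mem.mpr (Ideal.mem_span_singleton_self N)
  rw [hxy, map_add, map_mul, hN, zero_mul, zero_add, map_mul]
  exact dvd_mul_right _ _

/-- **Thm. (1-level quasi-cyclic product code).**  If the row-code `A` is the
1-level `ℓ`-quasi-cyclic code with RGB/POT generator row
`(g^A, g^A f_1, …, g^A f_{ℓ−1})` and the column-code `B` is the cyclic code
generated by `g^B`, then the component tuples of the serialized codewords of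
`A ⊗ B` form exactly the `R`-submodule of `R^ℓ` (`R = F[X]/(X^{m_A·m_B} − 1)`)
generated by the single row `(ḡ, ḡ·f_1(v)·w^{−1}, …, ḡ·f_{ℓ−1}(v)·w^{−(ℓ−1)})`,
where `g = gcd(X^{m_A·m_B} − 1, g^A(v)·g^B(u))`; in particular `A ⊗ B` is a
1-level `ℓ`-quasi-cyclic code. -/
theorem one_level_quasi_cyclic_product_code (F : Type*) [Field F] [Fintype F]
    (ℓ mA mB : ℕ) (hℓ : 1 ≤ ℓ) (hmA : 1 ≤ mA) (hmB : 1 ≤ mB)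
    (hgcd : Nat.gcd (ℓ * mA) mB = 1) (a b : ℤ) (hab : a * ℓ * mA + b * mB = 1)
    (gA : Polynomial F) (hgA : gA ∣ X ^ mA - 1)
    (f : Fin ℓ → Polynomial F) (hf0 : f ⟨0, hℓ⟩ = 1)
    (gB : Polynomial F) (hgB : gB ∣ X ^ mB - 1)
    (p : Polynomial F)
    (hp : Ideal.Quotient.mk (Ideal.span {(X : Polynomial F) ^ (mA * mB) - 1}) p =
      Polynomial.aeval
          (↑(Xu F (mA * mB) (Nat.mul_pos hmA hmB) ^ (b * mB)) : QR F (mA * mB)) gA *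
        Polynomial.aeval
          (↑(Xu F (mA * mB) (Nat.mul_pos hmA hmB) ^ (a * ℓ * mA)) : QR F (mA * mB)) gB)
    (g : Polynomial F) (hg : g = gcd ((X : Polynomial F) ^ (mA * mB) - 1) p)
    (T : Set (Fin ℓ → QR F (mA * mB)))
    (hT : T = {t | ∃ M : Fin mB → Fin (ℓ * mA) → F,
      (∀ i : Fin mB,
        (fun h : Fin ℓ => Ideal.Quotient.mk (Ideal.span {(X : Polynomial F) ^ mA - 1})
            (∑ j : Fin mA, C (M i (idx j h)) * X ^ (j : ℕ))) ∈
          Submodule.span (Polynomial F)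
            {fun h : Fin ℓ => Ideal.Quotient.mk (Ideal.span {(X : Polynomial F) ^ mA - 1})
              (gA * f h)}) ∧
      (∀ j : Fin (ℓ * mA), gB ∣ ∑ i : Fin mB, C (M i j) * X ^ (i : ℕ)) ∧
      ∀ h : Fin ℓ, t h = Ideal.Quotient.mk (Ideal.span {(X : Polynomial F) ^ (mA * mB) - 1})
        (serComp F ℓ mA mB a b M (h : ℕ))}) :
    T = (Submodule.span (QR F (mA * mB))
      {fun h : Fin ℓ =>
        Ideal.Quotient.mk (Ideal.span {(X : Polynomial F) ^ (mA * mB) - 1}) g *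
          Polynomial.aeval
            (↑(Xu F (mA * mB) (Nat.mul_pos hmA hmB) ^ (b * mB)) : QR F (mA * mB)) (f h) *
          ↑(Xu F (mA * mB) (Nat.mul_pos hmA hmB) ^ (-((h : ℕ) : ℤ) * a * mA))} :
      Set (Fin ℓ → QR F (mA * mB))) := by
  have hpos : 0 < mA * mB := Nat.mul_pos hmA hmB
  set U := Xu F (mA * mB) (Nat.mul_pos hmA hmB) with hU
  set u : QR F (mA * mB) := ↑(U ^ (a * ℓ * mA)) with hu
  set v : QR F (mA * mB) := ↑(U ^ (b * mB)) with hv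
  have hu1 : u ^ mB = 1 :=
    Xu_zpow_mul_pow_eq_one F (mA * mB) hpos ⟨a * ℓ, by push_cast; ring⟩
  have hv1 : v ^ mA = 1 :=
    Xu_zpow_mul_pow_eq_one F (mA * mB) hpos ⟨b, by push_cast; ring⟩
  have huv : u * v = Ideal.Quotient.mk (Ideal.span {(X : F[X]) ^ (mA * mB) - 1}) X := by
    rw [hu, hv, ← Units.val_mul, ← zpow_add, hab, zpow_one]
    rfl
  have hmk (r : F[X]) :
      Ideal.Quotient.mk (Ideal.span {(X : F[X]) ^ (mA * mB) - 1}) r = aeval (u * v) r := by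
    rw [huv]
    have := aeval_algHom_apply (Ideal.Quotient.mkₐ F (Ideal.span {(X : F[X]) ^ (mA * mB) - 1})) X r
    rw [aeval_X_left_apply] at this
    exact this.symm
  have hgA0 : gA ≠ 0 := by
    rintro rfl
    exact (monic_X_pow_sub_C (1 : F) (by omega : mA ≠ 0)).ne_zero (zero_dvd_iff.mp hgA)
  obtain ⟨⟨s, hs⟩, ⟨s', hs'⟩⟩ := mk_gcd_dvd_mk_and_mk_dvd_mk_gcd ((X : F[X]) ^ (mA * mB) - 1) p
  rw [← hg] at hs hs'
  rw [hp] at hs hs'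
  rw [hT]
  ext t
  rw [Set.mem_ofPred_eq, SetLike.mem_coe, Submodule.mem_span_singleton]
  constructor
  · rintro ⟨M, hrow, hcol, ht⟩
    have hrow' (i : Fin mB) : ∃ q : F[X], ∀ h : Fin ℓ,
        Ideal.Quotient.mk (Ideal.span {(X : F[X]) ^ mA - 1})
          (∑ j : Fin mA, C (M i (idx j h)) * X ^ (j : ℕ)) =
        Ideal.Quotient.mk _ (q * (gA * f h)) := by
      obtain ⟨q, hq⟩ := Submodule.mem_span_singleton.mp (hrow i)
      exact ⟨q, fun h => (congrFun hq h).symm⟩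
    choose q hq using hrow'
    obtain ⟨r, hr⟩ := exists_sum_eq_mul_aeval_mul_aeval u v (p := gA) (q := gB) hgA0
      (fun i j => M i (idx j ⟨0, hℓ⟩))
      (fun i => by
        have := hq i ⟨0, hℓ⟩
        rw [hf0, Ideal.Quotient.eq, Ideal.mem_span_singleton] at this
        exact (dvd_sub_left (Dvd.intro_left (q i) (by rw [mul_one]))).mp (hgA.trans this))
      (fun j => hcol _)
    have hsum (h : Fin ℓ) : ∑ i : Fin mB, ∑ j : Fin mA,
        algebraMap F (QR F (mA * mB)) (M i (idx j h)) * u ^ (i : ℕ) * v ^ (j : ℕ) =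
        (∑ i : Fin mB, u ^ (i : ℕ) * aeval v (q i)) * aeval v gA * aeval v (f h) := by
      simp only [Finset.sum_mul]
      refine Finset.sum_congr rfl fun i _ => ?_
      have := aeval_eq_of_mk_eq hv1 (hq i h)
      simp only [map_sum, map_mul, map_pow, aeval_C, aeval_X] at this
      rw [mul_assoc, mul_assoc, ← this, Finset.mul_sum]
      exact Finset.sum_congr rfl fun j _ => by ring
    have h0 := hsum ⟨0, hℓ⟩
    rw [hf0, map_one, mul_one, hr] at h0
    refine ⟨r * s, ?_⟩
    ext h
    rw [ht, mk_serComp F hmA hmB hab, ← hU, ← hu, ← hv, hsum, ← h0, hs, Pi.smul_apply, smul_eq_mul]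
    ring
  · rintro ⟨r, rfl⟩
    obtain ⟨r', hr'⟩ := Ideal.Quotient.mk_surjective (r * s')
    obtain ⟨M, hM1, hM2, hM3⟩ := exists_codeword_matrix F hmA hmB hu1 hv1 gA gB hgB f r'
    refine ⟨M, hM1, hM2, fun h => ?_⟩
    rw [mk_serComp F hmA hmB hab, ← hU, ← hu, ← hv, hM3, ← hmk, hr', Pi.smul_apply, smul_eq_mul, hs']
    ring
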